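/- For every positive integer d with d ≥ 2 there exist constants C and n₀ depending only on d such that the following holds for all n ≥ n₀. Let 𝓕 ⊆ binom([n], d+1) be a family with VC-dimension at most d. Then there exist a set V ⊆ [n] with |V| = n−2 and a partition of 𝓕 into three pairwise disjoint families 𝓕¹, 𝓕², 𝓕³ such that |𝓕¹ ∪ 𝓕²| ≤ 0.1·|∂̄𝓕| + C·n^{d−2}, |{D ∈ ∂̄𝓖 : D ⊆ V}| ≥ (1 − 8d/n)·|∂̄𝓖| where 𝓖 = 𝓕² ∪ 𝓕³, and there exists an injection from 𝓕³ into the family 𝓢 = binom(V, d−1) ∪ (binom(V, d) \ ∂̄𝓕³); in particular |𝓕³| ≤ binom(n−2, d−1) + binom(n−2, d) − |∂̄𝓕³ ∩ binom(V, d)|. -/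

import Mathlib

open Finset

/-- `S` is shattered by the family `𝓕`. -/
def Shatters' {n : ℕ} (𝓕 : Finset (Finset (Fin n))) (S : Finset (Fin n)) : Prop :=
  ∀ A ⊆ S, ∃ F ∈ 𝓕, F ∩ S = A

/-- The VC-dimension of `𝓕` is at most `d`. -/
def VCDimLE {n : ℕ} (𝓕 : Finset (Finset (Fin n))) (d : ℕ) : Prop :=
  ∀ S : Finset (Fin n), Shatters' 𝓕 S → S.card ≤ d

/-- `T` is a `𝓖`-certificate of `F`: a proper subset of `F` such that no member of `𝓖`
meets `F` exactly in `T`. -/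
def IsCert {n : ℕ} (𝓖 : Finset (Finset (Fin n))) (F T : Finset (Fin n)) : Prop :=
  T ⊂ F ∧ ∀ F' ∈ 𝓖, F' ∩ F ≠ T

/-- `c` assigns to each member of `𝓖` a maximum `𝓖`-certificate. -/
def IsMaxCertAssignment {n : ℕ} (𝓖 : Finset (Finset (Fin n)))
    (c : Finset (Fin n) → Finset (Fin n)) : Prop :=
  ∀ F ∈ 𝓖, IsCert 𝓖 F (c F) ∧ ∀ T : Finset (Fin n), IsCert 𝓖 F T → T.card ≤ (c F).card

/-- The shadow `∂𝓗`: all sets obtained from a member of `𝓗` by removing one element. -/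
def shadow' {n : ℕ} (𝓗 : Finset (Finset (Fin n))) : Finset (Finset (Fin n)) :=
  Finset.univ.filter (fun S => ∃ F ∈ 𝓗, S ⊆ F ∧ S.card + 1 = F.card)

/-- `∂̄𝓗 = binom([n], d) \ ∂𝓗`. -/
def compShadow {n : ℕ} (d : ℕ) (𝓗 : Finset (Finset (Fin n))) : Finset (Finset (Fin n)) :=
  Finset.powersetCard d (Finset.univ : Finset (Fin n)) \ shadow' 𝓗

/-- The index family `𝓢 = binom(V, d−1) ∪ (binom(V, d) \ ∂̄𝓗)`. -/
def famS {n : ℕ} (d : ℕ) (V : Finset (Fin n)) (𝓗 : Finset (Finset (Fin n))) :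
    Finset (Finset (Fin n)) :=
  Finset.powersetCard (d - 1) V ∪ (Finset.powersetCard d V \ compShadow d 𝓗)

variable {n d : ℕ} {𝓕 : Finset (Finset (Fin n))} {c : Finset (Fin n) → Finset (Fin n)}

theorem exists_isMaxCertAssignment (hu : ∀ F ∈ 𝓕, F.card = d + 1) (hvc : VCDimLE 𝓕 d) :
    ∃ c, IsMaxCertAssignment 𝓕 c := by
  classical
  have key : ∀ F : Finset (Fin n), ∃ T, F ∈ 𝓕 →
      IsCert 𝓕 F T ∧ ∀ T' : Finset (Fin n), IsCert 𝓕 F T' → T'.card ≤ T.card := by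
    intro F
    by_cases hF : F ∈ 𝓕
    · have hns : ¬ Shatters' 𝓕 F := fun h => by
        have := hvc F h
        have := hu F hF
        omega
      have hne : ((univ : Finset (Finset (Fin n))).filter (IsCert 𝓕 F)).Nonempty := by
        unfold Shatters' at hns
        push Not at hns
        obtain ⟨A, hA, hA'⟩ := hns
        have hne : A ≠ F := by
          rintro rfl
          exact hA' A hF (inter_self A)
        exact ⟨A, mem_filter.2 ⟨mem_univ _, hA.ssubset_of_ne hne, hA'⟩⟩
      obtain ⟨T, hT, hmax⟩ := exists_max_image _ Finset.card hne
      exact ⟨T, fun _ => ⟨(mem_filter.1 hT).2, fun T' h' => hmax T' (by simpa using h')⟩⟩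
    · exact ⟨∅, fun h => absurd h hF⟩
  choose c hc using key
  exact ⟨c, fun F hF => hc F hF⟩

theorem IsMaxCertAssignment.subset (hc : IsMaxCertAssignment 𝓕 c) {F : Finset (Fin n)}
    (hF : F ∈ 𝓕) : c F ⊆ F :=
  (hc F hF).1.1.1

theorem IsMaxCertAssignment.card_le (hu : ∀ F ∈ 𝓕, F.card = d + 1)
    (hc : IsMaxCertAssignment 𝓕 c) {F : Finset (Fin n)} (hF : F ∈ 𝓕) : (c F).card ≤ d := by
  have := card_lt_card (hc F hF).1.1
  have := hu F hF
  omega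

/-- A set of size larger than the maximum certificate is the trace of some member. -/
theorem IsMaxCertAssignment.exists_inter_eq (hc : IsMaxCertAssignment 𝓕 c)
    {F T : Finset (Fin n)} (hF : F ∈ 𝓕) (hT : T ⊆ F) (hcard : (c F).card < T.card) :
    ∃ F' ∈ 𝓕, F' ∩ F = T := by
  rcases eq_or_ne T F with rfl | hne
  · exact ⟨T, hF, inter_self T⟩
  · by_contra! h
    have := (hc F hF).2 T ⟨hT.ssubset_of_ne hne, h⟩
    omega

/-- A certificate of size `d` is contained in a single member. -/
theorem IsCert.eq_of_subset (hu : ∀ F ∈ 𝓕, F.card = d + 1) {F F' T : Finset (Fin n)}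
    (hF : F ∈ 𝓕) (hT : IsCert 𝓕 F T) (hcard : T.card = d) (hF' : F' ∈ 𝓕) (hsub : T ⊆ F') :
    F' = F := by
  have h1 : T ⊆ F' ∩ F := subset_inter hsub hT.1.1
  have h2 : T ⊂ F' ∩ F := h1.ssubset_of_ne (hT.2 F' hF').symm
  have h3 := card_lt_card h2
  have h4 : F' ∩ F = F' := eq_of_subset_of_card_le inter_subset_left (by rw [hu F' hF']; omega)
  have h5 : F' ∩ F = F := eq_of_subset_of_card_le inter_subset_right (by rw [hu F hF]; omega)
  rw [← h4, h5]

theorem card_filter_cert_superset_le (hu : ∀ F ∈ 𝓕, F.card = d + 1)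
    (hc : IsMaxCertAssignment 𝓕 c) (B : Finset (Fin n)) (k : ℕ) (Q : Finset (Fin n))
    (hBQ : B ⊆ Q) :
    (𝓕.filter (fun F => c F = B ∧ Q ⊆ F ∧ F.card ≤ Q.card + k)).card ≤ (d + 1) ^ k := by
  classical
  induction k generalizing Q with
  | zero =>
    rw [pow_zero, card_le_one]
    intro F hF G hG
    simp only [mem_filter, add_zero] at hF hG
    rw [← eq_of_subset_of_card_le hF.2.2.1 hF.2.2.2, ← eq_of_subset_of_card_le hG.2.2.1 hG.2.2.2]
  | succ k ih =>
    by_cases h : ∃ E ∈ 𝓕, B ⊆ E ∧ E ∩ Q ⊆ B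
    · obtain ⟨E, hE, hBE, hEQ⟩ := h
      have hsub : 𝓕.filter (fun F => c F = B ∧ Q ⊆ F ∧ F.card ≤ Q.card + (k + 1)) ⊆
          (E \ Q).biUnion (fun a =>
            𝓕.filter (fun F => c F = B ∧ insert a Q ⊆ F ∧ F.card ≤ (insert a Q).card + k)) := by
        intro F hF
        simp only [mem_filter] at hF
        obtain ⟨hF, rfl, hQ, hcard⟩ := hF
        have hne := (hc F hF).1.2 E hE
        have hss : c F ⊂ E ∩ F := (subset_inter hBE (hc.subset hF)).ssubset_of_ne hne.symm
        obtain ⟨a, ha, hac⟩ := exists_of_ssubset hss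
        rw [mem_inter] at ha
        have haQ : a ∉ Q := fun h => hac (hEQ (mem_inter.2 ⟨ha.1, h⟩))
        simp only [mem_biUnion, mem_filter, mem_sdiff]
        refine ⟨a, ⟨ha.1, haQ⟩, hF, trivial, insert_subset ha.2 hQ, ?_⟩
        rw [card_insert_of_notMem haQ]
        omega
      calc _ ≤ _ := card_le_card hsub
        _ ≤ (E \ Q).card * (d + 1) ^ k :=
          card_biUnion_le_card_mul _ _ _ fun a _ => ih _ (hBQ.trans (subset_insert _ _))
        _ ≤ (d + 1) * (d + 1) ^ k := by
          gcongr
          exact (card_le_card sdiff_subset).trans (hu E hE).le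
        _ = _ := by ring
    · push Not at h
      refine le_trans (card_le_one.2 ?_) (Nat.one_le_pow _ _ (Nat.succ_pos d))
      have heq : ∀ F ∈ 𝓕.filter (fun F => c F = B ∧ Q ⊆ F ∧ F.card ≤ Q.card + (k + 1)),
          F = Q := by
        intro F hF
        simp only [mem_filter] at hF
        obtain ⟨hF, rfl, hQ, -⟩ := hF
        refine (Subset.antisymm hQ fun a ha => ?_).symm
        by_contra haQ
        have hac : a ∉ c F := fun h => haQ (hBQ h)
        obtain ⟨E, hE, hEF⟩ := hc.exists_inter_eq hF
          (insert_subset ha (hc.subset hF)) (by rw [card_insert_of_notMem hac]; omega)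
        have hsub : c F ⊆ E :=
          (subset_insert a _).trans (hEF ▸ inter_subset_left)
        refine h E hE hsub fun b hb => ?_
        rw [mem_inter] at hb
        have : b ∈ insert a (c F) := hEF ▸ mem_inter.2 ⟨hb.1, hQ hb.2⟩
        rcases mem_insert.1 this with rfl | h'
        · exact absurd hb.2 haQ
        · exact h'
      intro F hF G hG
      rw [heq F hF, heq G hG]

theorem card_filter_cert_eq_le (hu : ∀ F ∈ 𝓕, F.card = d + 1)
    (hc : IsMaxCertAssignment 𝓕 c) (B : Finset (Fin n)) :
    (𝓕.filter (fun F => c F = B)).card ≤ (d + 1) ^ (d + 1) := by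
  refine le_trans (card_le_card fun F hF => ?_)
    (card_filter_cert_superset_le hu hc B (d + 1) B Subset.rfl)
  simp only [mem_filter] at hF ⊢
  have := hu F hF.1
  exact ⟨hF.1, hF.2, hF.2 ▸ hc.subset hF.1, by omega⟩

theorem card_filter_cert_mem_le (hu : ∀ F ∈ 𝓕, F.card = d + 1)
    (hc : IsMaxCertAssignment 𝓕 c) (𝓑 : Finset (Finset (Fin n))) :
    (𝓕.filter (fun F => c F ∈ 𝓑)).card ≤ 𝓑.card * (d + 1) ^ (d + 1) := by
  classical
  refine le_trans (card_le_card (t := 𝓑.biUnion fun B => 𝓕.filter (fun F => c F = B)) ?_)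
    (card_biUnion_le_card_mul _ _ _ fun B _ => card_filter_cert_eq_le hu hc B)
  intro F hF
  simp only [mem_filter, mem_biUnion] at hF ⊢
  exact ⟨c F, hF.2, hF.1, rfl⟩

theorem card_filter_card_le (hn : 1 ≤ n) (j : ℕ) :
    ((univ : Finset (Finset (Fin n))).filter (fun B => B.card ≤ j)).card ≤ (j + 1) * n ^ j := by
  classical
  have hsub : (univ : Finset (Finset (Fin n))).filter (fun B => B.card ≤ j) ⊆
      (range (j + 1)).biUnion (fun i => powersetCard i univ) := by
    intro B hB
    simp only [mem_filter, mem_biUnion, mem_range, mem_powersetCard] at hB ⊢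
    exact ⟨B.card, by omega, subset_univ _, rfl⟩
  refine (card_le_card hsub).trans ((card_biUnion_le_card_mul _ _ (n ^ j) ?_).trans ?_)
  · intro i hi
    rw [card_powersetCard, card_univ, Fintype.card_fin]
    exact (Nat.choose_le_pow n i).trans
      (Nat.pow_le_pow_right hn (Nat.lt_succ_iff.1 (mem_range.1 hi)))
  · rw [card_range]

theorem card_filter_cert_card_le (hn : 1 ≤ n) (hu : ∀ F ∈ 𝓕, F.card = d + 1)
    (hc : IsMaxCertAssignment 𝓕 c) (j : ℕ) :
    (𝓕.filter (fun F => (c F).card ≤ j)).card ≤ (j + 1) * n ^ j * (d + 1) ^ (d + 1) := by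
  have h := card_filter_cert_mem_le hu hc (univ.filter (fun B => B.card ≤ j))
  simp only [mem_filter, mem_univ, true_and] at h
  exact h.trans (Nat.mul_le_mul_right _ (card_filter_card_le hn j))

theorem card_filter_cert_subset_le (hu : ∀ F ∈ 𝓕, F.card = d + 1)
    (hc : IsMaxCertAssignment 𝓕 c) {H : Finset (Fin n)} {m : ℕ} (hH : H.card ≤ m) :
    (𝓕.filter (fun F => c F ⊆ H)).card ≤ 2 ^ m * (d + 1) ^ (d + 1) := by
  have h := card_filter_cert_mem_le hu hc H.powerset
  simp only [mem_powerset, card_powerset] at h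
  exact h.trans (Nat.mul_le_mul_right _ (Nat.pow_le_pow_right two_pos hH))

/-- `F` and `F'` have distinct certificates of size `d - 1`, each contained in both sets. -/
def CertConflict (d : ℕ) (𝓕 : Finset (Finset (Fin n))) (c : Finset (Fin n) → Finset (Fin n))
    (F F' : Finset (Fin n)) : Prop :=
  F' ∈ 𝓕 ∧ (c F).card + 1 = d ∧ (c F').card + 1 = d ∧ c F ≠ c F' ∧ c F ⊆ F' ∧ c F' ⊆ F

theorem exists_eq_insert_of_card {D F : Finset (Fin n)} (h : D ⊆ F) (hc : F.card = D.card + 1) :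
    ∃ w, w ∉ D ∧ F = insert w D := by
  have h1 : (F \ D).card = 1 := by rw [card_sdiff_of_subset h]; omega
  obtain ⟨w, hw⟩ := card_eq_one.1 h1
  have hmem : w ∈ F \ D := hw ▸ mem_singleton_self w
  refine ⟨w, (mem_sdiff.1 hmem).2, ?_⟩
  rw [← union_sdiff_of_subset h, hw, union_comm]
  rfl

theorem CertConflict.card_union (hu : ∀ F ∈ 𝓕, F.card = d + 1)
    (hc : IsMaxCertAssignment 𝓕 c) {F F' : Finset (Fin n)} (hF : F ∈ 𝓕)
    (h : CertConflict d 𝓕 c F F') : (c F ∪ c F').card = d := by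
  obtain ⟨hF', h1, h2, hne, h3, h4⟩ := h
  have hsub : c F ∪ c F' ⊆ F ∩ F' :=
    union_subset (subset_inter (hc.subset hF) h3) (subset_inter h4 (hc.subset hF'))
  have hlt : (F ∩ F').card < F.card := by
    refine card_lt_card (inter_subset_left.ssubset_of_ne fun h => hne ?_)
    have : F = F' := eq_of_subset_of_card_le (inter_eq_left.1 h) (by rw [hu F hF, hu F' hF'])
    rw [this]
  have hgt : (c F).card < (c F ∪ c F').card := by
    refine card_lt_card (subset_union_left.ssubset_of_ne fun h => hne ?_)
    have : c F' ⊆ c F := union_eq_left.1 h.symm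
    exact (eq_of_subset_of_card_le this (by omega)).symm
  have := card_le_card hsub
  have := hu F hF
  omega

theorem CertConflict.card_inter (hu : ∀ F ∈ 𝓕, F.card = d + 1)
    (hc : IsMaxCertAssignment 𝓕 c) {F F' : Finset (Fin n)} (hF : F ∈ 𝓕)
    (h : CertConflict d 𝓕 c F F') : (c F ∩ c F').card + 2 = d := by
  have h1 := h.card_union hu hc hF
  have h2 := card_union_add_card_inter (c F) (c F')
  obtain ⟨-, h3, h4, -⟩ := h
  omega

theorem CertConflict.inter_eq_or_inter_eq (hu : ∀ F ∈ 𝓕, F.card = d + 1)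
    (hc : IsMaxCertAssignment 𝓕 c) {F F' G G' R : Finset (Fin n)} (hF : F ∈ 𝓕) (hG : G ∈ 𝓕)
    (h : CertConflict d 𝓕 c F F') (hR : c F ∩ c F' = R)
    (k : CertConflict d 𝓕 c G G') (kR : c G ∩ c G' = R)
    (hd : (c G ∪ c G') ∩ (F ∪ F') ⊆ R) : F ∩ G = R ∨ F ∩ G' = R := by
  have hRc : R.card + 2 = d := hR ▸ h.card_inter hu hc hF
  have hU := h.card_union hu hc hF
  have kU := k.card_union hu hc hG
  obtain ⟨hF', h1, h2, hne, h3, h4⟩ := h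
  obtain ⟨hG', k1, k2, kne, k3, k4⟩ := k
  set D := c G ∪ c G' with hD
  obtain ⟨w, hwD, hw⟩ := exists_eq_insert_of_card (union_subset (hc.subset hG) k4)
    (show G.card = D.card + 1 by rw [kU, hu G hG])
  obtain ⟨w', hwD', hw'⟩ := exists_eq_insert_of_card (union_subset k3 (hc.subset hG'))
    (show G'.card = D.card + 1 by rw [kU, hu G' hG'])
  obtain ⟨v, hvD, hv⟩ := exists_eq_insert_of_card (union_subset (hc.subset hF) h4)
    (show F.card = (c F ∪ c F').card + 1 by rw [hU, hu F hF])
  have hRF : R ⊆ c F := hR ▸ inter_subset_left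
  have hRF' : R ⊆ c F' := hR ▸ inter_subset_right
  have hRD : R ⊆ D := (kR ▸ inter_subset_left : R ⊆ c G).trans subset_union_left
  have hFD : F ∩ D = R := by
    refine Subset.antisymm (fun a ha => ?_) (subset_inter (hRF.trans (hc.subset hF)) hRD)
    rw [mem_inter] at ha
    exact hd (mem_inter.2 ⟨ha.2, mem_union_left _ ha.1⟩)
  have hFD' : F' ∩ D = R := by
    refine Subset.antisymm (fun a ha => ?_) (subset_inter (hRF'.trans (hc.subset hF')) hRD)
    rw [mem_inter] at ha
    exact hd (mem_inter.2 ⟨ha.2, mem_union_right _ ha.1⟩)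
  -- an element of `F` completing `D` to a member can only be `v`
  have main : ∀ u, u ∉ D → insert u D ∈ 𝓕 → F ∩ insert u D ≠ R → u = v := by
    intro u huD huF hne
    have huR : u ∉ R := fun h => huD (hRD h)
    by_cases huf : u ∈ F
    · rw [hv, mem_insert, mem_union] at huf
      rcases huf with h | h | h
      · exact h
      · have he : insert u R = c F :=
          eq_of_subset_of_card_le (insert_subset h hRF) (by rw [card_insert_of_notMem huR]; omega)
        refine absurd ?_ ((hc F hF).1.2 _ huF)
        rw [insert_inter_of_mem (hc.subset hF h), inter_comm, hFD, he]
      · have he : insert u R = c F' :=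
          eq_of_subset_of_card_le (insert_subset h hRF') (by rw [card_insert_of_notMem huR]; omega)
        refine absurd ?_ ((hc F' hF').1.2 _ huF)
        rw [insert_inter_of_mem (hc.subset hF' h), inter_comm, hFD', he]
    · exact absurd (by rw [inter_insert_of_notMem huf, hFD]) hne
  by_contra! hcon
  have e1 := main w hwD (hw ▸ hG) (hw ▸ hcon.1)
  have e2 := main w' hwD' (hw' ▸ hG') (hw' ▸ hcon.2)
  exact kne (congrArg c (hw.trans ((congrArg (fun u => insert u D) (e1.trans e2.symm)).trans
    hw'.symm)))

theorem union_cert_mem_compShadow (hc : IsMaxCertAssignment 𝓕 c) {F G R : Finset (Fin n)} (hF : F ∈ 𝓕) (hG : G ∈ 𝓕)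
    (hR : R.card + 2 = d) (hRF : R ⊆ c F) (hRG : R ⊆ c G) (hcF : (c F).card + 1 = d)
    (hcG : (c G).card + 1 = d) (h : F ∩ G = R) : c F ∪ c G ∈ compShadow d 𝓕 := by
  have hi : c F ∩ c G = R := Subset.antisymm
    (h ▸ inter_subset_inter (hc.subset hF) (hc.subset hG)) (subset_inter hRF hRG)
  have hcard : (c F ∪ c G).card = d := by
    have := card_union_add_card_inter (c F) (c G)
    rw [hi] at this
    omega
  simp only [compShadow, shadow', mem_sdiff, mem_powersetCard, subset_univ, true_and, mem_filter,
    mem_univ, hcard, not_exists, not_and]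
  intro H hH hsub hHc
  obtain ⟨u, -, hHu⟩ := exists_eq_insert_of_card hsub (by omega)
  have main : ∀ A ∈ 𝓕, ∀ B, c A ⊆ H → H = insert u (c A ∪ c B) → c B ∩ A ⊆ c A → u ∈ A := by
    intro A hA B hAH hHu hBA
    have hss : c A ⊂ H ∩ A :=
      (subset_inter hAH (hc.subset hA)).ssubset_of_ne ((hc A hA).1.2 H hH).symm
    obtain ⟨a, ha, hac⟩ := exists_of_ssubset hss
    rw [mem_inter, hHu, mem_insert, mem_union] at ha
    obtain ⟨rfl | ha | ha, haA⟩ := ha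
    · exact haA
    · exact absurd ha hac
    · exact absurd (hBA (mem_inter.2 ⟨ha, haA⟩)) hac
  have u1 : u ∈ F := main F hF G (subset_union_left.trans hsub) hHu fun a ha => by
    rw [mem_inter] at ha
    exact hRF (h ▸ mem_inter.2 ⟨ha.2, hc.subset hG ha.1⟩)
  have u2 : u ∈ G := main G hG F (subset_union_right.trans hsub) (by rw [hHu, union_comm])
    fun a ha => by
      rw [mem_inter] at ha
      exact hRG (h ▸ mem_inter.2 ⟨hc.subset hF ha.1, ha.2⟩)
  have u3 : u ∈ c F ∪ c G := mem_union_left _ (hRF (h ▸ mem_inter.2 ⟨u1, u2⟩))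
  rw [hHu, insert_eq_of_mem u3] at hHc
  omega

/-- The members whose certificate lies in `H`, or in a member whose certificate lies in `H`. -/
def certNear (𝓕 : Finset (Finset (Fin n))) (c : Finset (Fin n) → Finset (Fin n))
    (H : Finset (Fin n)) : Finset (Finset (Fin n)) :=
  𝓕.filter (fun G => c G ⊆ H) ∪
    (𝓕.filter (fun G => c G ⊆ H)).biUnion (fun H' => 𝓕.filter (fun G => c G ⊆ H'))

/-- A bound for the size of `certNear`. -/
def certNearBound (d : ℕ) : ℕ :=
  2 ^ d * (d + 1) ^ (d + 1) +
    2 ^ d * (d + 1) ^ (d + 1) * (2 ^ (d + 1) * (d + 1) ^ (d + 1))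

theorem card_certNear_le (hu : ∀ F ∈ 𝓕, F.card = d + 1) (hc : IsMaxCertAssignment 𝓕 c)
    {H : Finset (Fin n)} (hH : H.card ≤ d) : (certNear 𝓕 c H).card ≤ certNearBound d := by
  have h1 := card_filter_cert_subset_le hu hc hH
  refine (card_union_le _ _).trans (add_le_add h1 ?_)
  refine (card_biUnion_le_card_mul _ _ _ fun H' hH' => ?_).trans (Nat.mul_le_mul_right _ h1)
  exact card_filter_cert_subset_le hu hc (hu H' (mem_filter.1 hH').1).le

open Classical in
theorem card_certConflict_sq_le (hu : ∀ F ∈ 𝓕, F.card = d + 1) (hc : IsMaxCertAssignment 𝓕 c)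
    (R : Finset (Fin n)) :
    (𝓕.filter (fun F => ∃ F', CertConflict d 𝓕 c F F' ∧ c F ∩ c F' = R)).card ^ 2 ≤
      2 * (d + 1) * certNearBound d *
        (𝓕.filter (fun F => ∃ F', CertConflict d 𝓕 c F F' ∧ c F ∩ c F' = R)).card +
      certNearBound d ^ 2 * ((compShadow d 𝓕).filter (fun E => R ⊆ E)).card := by
  set T := 𝓕.filter (fun F => ∃ F', CertConflict d 𝓕 c F F' ∧ c F ∩ c F' = R) with hT
  set K := certNearBound d
  have hex : ∀ F : Finset (Fin n), ∃ F', F ∈ T → CertConflict d 𝓕 c F F' ∧ c F ∩ c F' = R := by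
    intro F
    by_cases hF : F ∈ T
    · obtain ⟨F', h⟩ := (mem_filter.1 hF).2
      exact ⟨F', fun _ => h⟩
    · exact ⟨∅, fun h => absurd h hF⟩
  choose π hπ using hex
  have hTF : ∀ F ∈ T, F ∈ 𝓕 := fun F hF => (mem_filter.1 hF).1
  have hnear : ∀ G ∈ T, ∀ H, (c G ⊆ H ∨ c (π G) ⊆ H) → G ∈ certNear 𝓕 c H := by
    intro G hG H h
    simp only [certNear, mem_union, mem_biUnion, mem_filter]
    rcases h with h | h
    · exact Or.inl ⟨hTF G hG, h⟩
    · exact Or.inr ⟨π G, ⟨(hπ G hG).1.1, h⟩, hTF G hG, (hπ G hG).1.2.2.2.2.1⟩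
  have hcover : T ×ˢ T ⊆
      (T.biUnion fun F => ((F ∪ π F) \ R).biUnion fun s =>
        ({F} : Finset (Finset (Fin n))) ×ˢ certNear 𝓕 c (insert s R)) ∪
      ((compShadow d 𝓕).filter (fun E => R ⊆ E)).biUnion fun E =>
        certNear 𝓕 c E ×ˢ certNear 𝓕 c E := by
    rintro ⟨F, G⟩ hFG
    obtain ⟨hF, hG⟩ := mem_product.1 hFG
    obtain ⟨h, hR⟩ := hπ F hF
    obtain ⟨k, kR⟩ := hπ G hG
    have hRc : R.card + 2 = d := hR ▸ h.card_inter hu hc (hTF F hF)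
    have hRF : R ⊆ c F := hR ▸ inter_subset_left
    have hRG : R ⊆ c G := kR ▸ inter_subset_left
    have hRG' : R ⊆ c (π G) := kR ▸ inter_subset_right
    rw [mem_union]
    by_cases hd : (c G ∪ c (π G)) ∩ (F ∪ π F) ⊆ R
    · right
      have hor : ∃ E ∈ compShadow d 𝓕, c F ⊆ E ∧ (c G ⊆ E ∨ c (π G) ⊆ E) := by
        rcases h.inter_eq_or_inter_eq hu hc (hTF F hF) (hTF G hG) hR k kR hd with h' | h'
        · exact ⟨c F ∪ c G, union_cert_mem_compShadow hc (hTF F hF) (hTF G hG) hRc hRF hRG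
            h.2.1 k.2.1 h', subset_union_left, Or.inl subset_union_right⟩
        · exact ⟨c F ∪ c (π G), union_cert_mem_compShadow hc (hTF F hF) k.1 hRc hRF hRG'
            h.2.1 k.2.2.1 h', subset_union_left, Or.inr subset_union_right⟩
      obtain ⟨E, hE, hFE, hGE⟩ := hor
      exact mem_biUnion.2 ⟨E, mem_filter.2 ⟨hE, hRF.trans hFE⟩,
        mem_product.2 ⟨hnear F hF E (Or.inl hFE), hnear G hG E hGE⟩⟩
    · left
      obtain ⟨s, hs, hsR⟩ := not_subset.1 hd
      rw [mem_inter, mem_union] at hs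
      refine mem_biUnion.2 ⟨F, hF, mem_biUnion.2 ⟨s, mem_sdiff.2 ⟨hs.2, hsR⟩,
        mem_product.2 ⟨mem_singleton_self F, hnear G hG _ ?_⟩⟩⟩
      have hins : ∀ B, s ∈ B → R ⊆ B → B.card + 1 = d → B ⊆ insert s R := fun B hs hRB hB =>
        (eq_of_subset_of_card_le (insert_subset hs hRB)
          (by rw [card_insert_of_notMem hsR]; omega)).ge
      exact hs.1.imp (fun h => hins _ h hRG k.2.1) (fun h => hins _ h hRG' k.2.2.1)
  have hcard := (card_le_card hcover).trans (card_union_le _ _)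
  rw [card_product, ← sq] at hcard
  refine hcard.trans (add_le_add ?_ ?_)
  · refine (card_biUnion_le_card_mul _ _ (2 * (d + 1) * K) fun F hF => ?_).trans
      (mul_comm _ _).le
    have hRc : R.card + 2 = d := (hπ F hF).2 ▸ (hπ F hF).1.card_inter hu hc (hTF F hF)
    refine (card_biUnion_le_card_mul _ _ K fun s hs => ?_).trans (Nat.mul_le_mul_right _ ?_)
    · rw [card_product, card_singleton, one_mul]
      refine card_certNear_le hu hc ?_
      have := card_insert_le s R
      omega
    · have := card_union_le F (π F)
      have := card_le_card (sdiff_subset (s := F ∪ π F) (t := R))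
      have := hu F (hTF F hF)
      have := hu (π F) (hπ F hF).1.1
      omega
  · refine (card_biUnion_le_card_mul _ _ (K ^ 2) fun E hE => ?_).trans (mul_comm _ _).le
    have hEd : E.card ≤ d := by
      have := (mem_filter.1 hE).1
      simp only [compShadow, mem_sdiff, mem_powersetCard] at this
      exact this.1.2.le
    rw [card_product, sq]
    exact Nat.mul_le_mul (card_certNear_le hu hc hEd) (card_certNear_le hu hc hEd)

theorem le_add_of_sq_le {t a b e ε : ℝ} (ha : 0 ≤ a) (hb : 0 ≤ b) (he : 0 ≤ e)
    (hε : 0 < ε) (h : t ^ 2 ≤ a * t + b * e) : t ≤ ε * e + (a + b / ε) := by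
  by_contra! hlt
  have h1 : a + b / ε < t := lt_of_le_of_lt (by nlinarith [mul_nonneg hε.le he]) hlt
  have h2 : b / ε < t - a := by linarith
  have h3 : b < (t - a) * ε := (div_lt_iff₀ hε).1 h2
  have h4 : ε * e < t := lt_of_le_of_lt (by nlinarith [div_nonneg hb hε.le]) hlt
  have h5 : 0 < t - a := lt_of_le_of_lt (div_nonneg hb hε.le) h2
  nlinarith [mul_le_mul_of_nonneg_right h3.le he, mul_lt_mul_of_pos_left h4 h5]

open Classical in
theorem card_certConflict_le (hd : 2 ≤ d) (hu : ∀ F ∈ 𝓕, F.card = d + 1)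
    (hc : IsMaxCertAssignment 𝓕 c) :
    ((𝓕.filter (fun F => ∃ F', CertConflict d 𝓕 c F F')).card : ℝ) ≤
      0.1 * (compShadow d 𝓕).card +
      (2 * (d + 1) * certNearBound d + certNearBound d ^ 2 * (10 * 2 ^ d)) * n ^ (d - 2) := by
  set K : ℝ := 2 * (d + 1) * certNearBound d + certNearBound d ^ 2 * (10 * 2 ^ d) with hK
  let T : Finset (Fin n) → Finset (Finset (Fin n)) := fun R =>
    𝓕.filter (fun F => ∃ F', CertConflict d 𝓕 c F F' ∧ c F ∩ c F' = R)
  let P : Finset (Finset (Fin n)) := powersetCard (d - 2) univ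
  have hcover : 𝓕.filter (fun F => ∃ F', CertConflict d 𝓕 c F F') ⊆ P.biUnion T := by
    intro F hF
    obtain ⟨hF, F', h⟩ := mem_filter.1 hF
    have := h.card_inter hu hc hF
    exact mem_biUnion.2 ⟨c F ∩ c F', mem_powersetCard.2 ⟨subset_univ _, by omega⟩,
      mem_filter.2 ⟨hF, F', h, rfl⟩⟩
  have hT : ∀ R ∈ P, ((T R).card : ℝ) ≤
      1 / (10 * 2 ^ d) * ((compShadow d 𝓕).filter (fun E => R ⊆ E)).card + K := by
    intro R _
    have h := card_certConflict_sq_le hu hc R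
    have h' : ((T R).card : ℝ) ^ 2 ≤ 2 * (d + 1) * certNearBound d * (T R).card +
        certNearBound d ^ 2 * ((compShadow d 𝓕).filter (fun E => R ⊆ E)).card := by
      exact_mod_cast h
    have := le_add_of_sq_le (ε := 1 / (10 * 2 ^ d)) (by positivity) (by positivity)
      (by positivity) (by positivity) h'
    rwa [div_div_eq_mul_div, div_one] at this
  have hdouble : ∑ R ∈ P, ((compShadow d 𝓕).filter (fun E => R ⊆ E)).card ≤
      2 ^ d * (compShadow d 𝓕).card := by
    refine (sum_card_bipartiteAbove_eq_sum_card_bipartiteBelow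
      (fun R E : Finset (Fin n) => R ⊆ E)).trans_le ?_
    rw [mul_comm, ← smul_eq_mul]
    refine sum_le_card_nsmul _ _ _ fun E hE => ?_
    have hEd : E.card = d := by
      simp only [compShadow, mem_sdiff, mem_powersetCard] at hE
      exact hE.1.2
    rw [← hEd, ← card_powerset]
    exact card_le_card fun R hR => mem_powerset.2 (mem_filter.1 hR).2
  have hP : (P.card : ℝ) ≤ n ^ (d - 2) := by
    rw [card_powersetCard, card_univ, Fintype.card_fin]
    exact_mod_cast Nat.choose_le_pow n (d - 2)
  have hdouble' : ∑ R ∈ P, (((compShadow d 𝓕).filter (fun E => R ⊆ E)).card : ℝ) ≤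
      2 ^ d * (compShadow d 𝓕).card := by exact_mod_cast hdouble
  calc ((𝓕.filter (fun F => ∃ F', CertConflict d 𝓕 c F F')).card : ℝ)
      ≤ ∑ R ∈ P, ((T R).card : ℝ) := by
        exact_mod_cast (card_le_card hcover).trans card_biUnion_le
    _ ≤ ∑ R ∈ P, (1 / (10 * 2 ^ d) *
          (((compShadow d 𝓕).filter (fun E => R ⊆ E)).card : ℝ) + K) := sum_le_sum hT
    _ = 1 / (10 * 2 ^ d) * ∑ R ∈ P, (((compShadow d 𝓕).filter (fun E => R ⊆ E)).card : ℝ) +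
          P.card * K := by rw [sum_add_distrib, mul_sum, sum_const, nsmul_eq_mul]
    _ ≤ 1 / (10 * 2 ^ d) * (2 ^ d * (compShadow d 𝓕).card) + n ^ (d - 2) * K := by
        gcongr
    _ = _ := by
        have : (2 : ℝ) ^ d ≠ 0 := by positivity
        field_simp
        ring

theorem card_add_card_filter_le {α : Type*} [DecidableEq α] {K 𝓛 : Finset (Finset α)} {z : α}
    {β : ℕ} (hKL : K ⊆ 𝓛) (h2 : ∀ e ∈ 𝓛, e.card = 2) (hint : ∀ e ∈ K, ∀ f ∈ 𝓛, ¬ Disjoint e f)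
    (hdeg : ∀ e ∈ K, ∀ v ∈ e, ∃ f ∈ 𝓛, f ≠ e ∧ v ∈ f) (hz : z ∉ K.biUnion id)
    (hβ : β = 0 ∨ β = 1 ∧ ∃ v, {z, v} ∈ 𝓛 ∧ ∀ w, {z, w} ∈ 𝓛 → w = v) :
    K.card + β + ((K.biUnion id).filter fun v => {z, v} ∈ 𝓛).card ≤
      1 + (K.biUnion id).card := by
  set U := K.biUnion id
  set N := U.filter fun v => {z, v} ∈ 𝓛
  have hKU : ∀ e ∈ K, e ⊆ U := fun e he => subset_biUnion_of_mem id he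
  have hall : ∀ v, {z, v} ∈ 𝓛 → ∀ e ∈ K, v ∈ e := by
    intro v hv e he
    obtain ⟨w, hwe, hw⟩ := not_disjoint_iff.1 (hint e he _ hv)
    rw [mem_insert, mem_singleton] at hw
    rcases hw with rfl | rfl
    · exact absurd (hKU e he hwe) hz
    · exact hwe
  have hNe : ∀ e ∈ K, N ⊆ e := fun e he v hv => hall v (mem_filter.1 hv).2 e he
  have hN1 : β = 0 ∨ β = 1 ∧ N.card ≤ 1 := by
    refine hβ.imp_right fun h => ⟨h.1, ?_⟩
    obtain ⟨v, -, hv⟩ := h.2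
    exact card_le_one.2 fun a ha b hb =>
      (hv a (mem_filter.1 ha).2).trans (hv b (mem_filter.1 hb).2).symm
  rcases K.eq_empty_or_nonempty with hK | ⟨e, he⟩
  · have hU : U.card = 0 := by simp [U, hK]
    have : N.card ≤ U.card := card_filter_le _ _
    have : K.card = 0 := by simp [hK]
    omega
  have hUe := card_le_card (hKU e he)
  have hNe' := card_le_card (hNe e he)
  rw [h2 e (hKL he)] at hUe hNe'
  rcases Nat.lt_or_ge 1 K.card with hK | hK
  swap
  · omega
  obtain ⟨e', he', hne⟩ := exists_mem_ne hK e
  obtain ⟨a, hae, hae'⟩ := not_disjoint_iff.1 (hint e he e' (hKL he'))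
  have hpair : ∀ f ∈ 𝓛, ∀ x ∈ f, ∃ y, y ≠ x ∧ f = {x, y} := by
    intro f hf x hx
    obtain ⟨p, q, hpq, rfl⟩ := card_eq_two.1 (h2 f hf)
    rw [mem_insert, mem_singleton] at hx
    rcases hx with rfl | rfl
    · exact ⟨q, hpq.symm, rfl⟩
    · exact ⟨p, hpq, pair_comm _ _⟩
  obtain ⟨b, hba, rfl⟩ := hpair e (hKL he) a hae
  obtain ⟨c, hca, rfl⟩ := hpair e' (hKL he') a hae'
  have hcb : c ≠ b := fun h => hne (by rw [h])
  have h3 : ({a, b, c} : Finset α).card = 3 := card_eq_three.2 ⟨a, b, c, hba.symm, hca.symm,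
    hcb.symm, rfl⟩
  have hmeet : ∀ p q, {p, q} ∈ K → ∀ f ∈ 𝓛, p ∈ f ∨ q ∈ f := fun p q hpq f hf => by
    simpa [not_disjoint_iff, or_iff_not_imp_left] using hint _ hpq f hf
  have hU3 : 3 ≤ U.card := by
    rw [← h3]
    exact card_le_card (insert_subset (hKU _ he (by simp)) (insert_subset (hKU _ he (by simp))
      (singleton_subset_iff.2 (hKU _ he' (by simp)))))
  have hcap : ∀ v, v ∈ ({a, b} : Finset α) → v ∈ ({a, c} : Finset α) → v = a := by
    intro v hv hv'
    rw [mem_insert, mem_singleton] at hv hv'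
    rcases hv with rfl | rfl
    · rfl
    · exact hv'.resolve_right hcb.symm
  have hNa' : N.card ≤ 1 := card_singleton a ▸ card_le_card fun v hv =>
    mem_singleton.2 (hcap v (hNe _ he hv) (hNe _ he' hv))
  by_cases hex : ∃ f ∈ K, a ∉ f
  · obtain ⟨f, hf, haf⟩ := hex
    have hb : b ∈ f := (hmeet a b he f (hKL hf)).resolve_left haf
    have hc : c ∈ f := (hmeet a c he' f (hKL hf)).resolve_left haf
    have hno : ∀ v, {z, v} ∉ 𝓛 := fun v hv =>
      haf (hcap v (hall v hv _ he) (hall v hv _ he') ▸ hall v hv _ hf)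
    have hN0 : N.card = 0 := card_eq_zero.2 (filter_eq_empty_iff.2 fun v _ => hno v)
    have hβ0 : β = 0 := hβ.resolve_right fun ⟨_, v, hv, _⟩ => hno v hv
    have hf' : f = {b, c} := (eq_of_subset_of_card_le
      (insert_subset hb (singleton_subset_iff.2 hc))
      (by rw [h2 f (hKL hf), card_pair hcb.symm])).symm
    have hsub : K ⊆ powersetCard 2 {a, b, c} := by
      intro g hg
      have hg2 := h2 g (hKL hg)
      refine mem_powersetCard.2 ⟨?_, hg2⟩
      have i1 := hmeet a b he g (hKL hg)
      have i2 := hmeet a c he' g (hKL hg)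
      have i3 := hmeet b c (hf' ▸ hf) g (hKL hg)
      obtain ⟨p, q, -, rfl⟩ := card_eq_two.1 hg2
      clear * - i1 i2 i3 hba hca hcb
      simp only [mem_insert, mem_singleton, insert_subset_iff, singleton_subset_iff] at *
      grind
    have := card_le_card hsub
    rw [card_powersetCard, h3] at this
    have : Nat.choose 3 2 = 3 := rfl
    omega
  · push Not at hex
    have hsub : K ⊆ {{a, b}, {a, c}} := by
      intro g hg
      obtain ⟨x, hxa, rfl⟩ := hpair g (hKL hg) a (hex g hg)
      obtain ⟨f, hf, hfe, hbf⟩ := hdeg _ he b (by simp)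
      have i2 := hmeet a c he' f hf
      have i3 := hmeet a x hg f hf
      obtain ⟨y, hyb, rfl⟩ := hpair f hf b hbf
      have hya : y ≠ a := fun h => hfe (by rw [h, pair_comm])
      have hxy : x = b ∨ x = c := by
        clear * - i2 i3 hba hca hcb hxa hya
        simp only [mem_insert, mem_singleton] at *
        grind
      rcases hxy with rfl | rfl <;> simp
    have := (card_le_card hsub).trans card_le_two
    omega

/-- The pairs completing `B` to a member of `𝓗`. -/
def linkPairs (𝓗 : Finset (Finset (Fin n))) (B : Finset (Fin n)) : Finset (Finset (Fin n)) :=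
  (𝓗.filter (fun F => B ⊆ F)).image (fun F => F \ B)

theorem mem_linkPairs {𝓗 : Finset (Finset (Fin n))} {B e : Finset (Fin n)} :
    e ∈ linkPairs 𝓗 B ↔ ∃ F ∈ 𝓗, B ⊆ F ∧ F \ B = e := by
  simp only [linkPairs, mem_image, mem_filter, and_assoc]

theorem card_linkPairs (𝓗 : Finset (Finset (Fin n))) (B : Finset (Fin n)) :
    (linkPairs 𝓗 B).card = (𝓗.filter (fun F => B ⊆ F)).card := by
  refine card_image_of_injOn fun F hF G hG h => ?_
  have hF' := (mem_filter.1 hF).2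
  have hG' := (mem_filter.1 hG).2
  rw [← sdiff_union_of_subset hF', ← sdiff_union_of_subset hG']
  exact congrArg (· ∪ B) h

theorem card_filter_cert_eq_le_card_sdiff_add (hu : ∀ F ∈ 𝓕, F.card = d + 1)
    (hc : IsMaxCertAssignment 𝓕 c) {z : Fin n} {I J : Finset (Finset (Fin n))}
    {B : Finset (Fin n)} (hB : B.card + 1 = d)
    (hI : ∀ F ∈ I, F ∈ 𝓕 ∧ c F = B ∧ z ∉ F)
    (hJ : ∀ F ∈ J, F ∈ 𝓕 ∧ (c F).card = d ∧ z ∈ c F) :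
    I.card ≤ (((linkPairs I B).biUnion id).filter fun v => {z, v} ∉ linkPairs 𝓕 B).card +
      if B ∈ J.image (fun F => (c F).erase z) then 0 else 1 := by
  have hBI : ∀ F ∈ I, B ⊆ F := fun F hF => (hI F hF).2.1 ▸ hc.subset (hI F hF).1
  have hcard : (linkPairs I B).card = I.card := by
    rw [card_linkPairs, filter_true_of_mem hBI]
  have h2 : ∀ e ∈ linkPairs 𝓕 B, e.card = 2 := by
    intro e he
    obtain ⟨F, hF, hBF, rfl⟩ := mem_linkPairs.1 he
    rw [card_sdiff_of_subset hBF, hu F hF]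
    omega
  have key := card_add_card_filter_le (K := linkPairs I B) (𝓛 := linkPairs 𝓕 B) (z := z)
    (β := if B ∈ J.image (fun F => (c F).erase z) then 1 else 0) ?_ h2 ?_ ?_ ?_ ?_
  · have := card_filter_add_card_filter_not (s := (linkPairs I B).biUnion id)
      (fun v => {z, v} ∈ linkPairs 𝓕 B)
    split_ifs at key ⊢ <;> omega
  · exact image_subset_image (filter_subset_filter _ fun F hF => (hI F hF).1)
  · intro e he f hf hdis
    obtain ⟨F, hF, hBF, rfl⟩ := mem_linkPairs.1 he
    obtain ⟨G, hG, hBG, rfl⟩ := mem_linkPairs.1 hf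
    refine (hc F (hI F hF).1).1.2 G hG ?_
    rw [(hI F hF).2.1]
    refine Subset.antisymm (fun v hv => ?_) (subset_inter hBG hBF)
    rw [mem_inter] at hv
    by_contra hvB
    exact disjoint_left.1 hdis (mem_sdiff.2 ⟨hv.2, hvB⟩) (mem_sdiff.2 ⟨hv.1, hvB⟩)
  · intro e he v hv
    obtain ⟨F, hF, hBF, rfl⟩ := mem_linkPairs.1 he
    rw [mem_sdiff] at hv
    obtain ⟨G, hG, hGF⟩ := hc.exists_inter_eq (T := insert v B) (hI F hF).1
      (insert_subset hv.1 hBF) (by rw [(hI F hF).2.1, card_insert_of_notMem hv.2]; omega)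
    have hins : insert v B ⊆ G := hGF ▸ inter_subset_left
    refine ⟨G \ B, mem_linkPairs.2 ⟨G, hG, (subset_insert _ _).trans hins, rfl⟩, fun h => ?_,
      mem_sdiff.2 ⟨hins (mem_insert_self _ _), hv.2⟩⟩
    have hGF' : F = G := by
      rw [← sdiff_union_of_subset hBF, ← h,
        sdiff_union_of_subset ((subset_insert _ _).trans hins)]
    have h1 := hu F (hI F hF).1
    rw [← hGF', inter_self] at hGF
    rw [hGF, card_insert_of_notMem hv.2] at h1
    omega
  · intro hz
    obtain ⟨e, he, hze⟩ := mem_biUnion.1 hz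
    obtain ⟨F, hF, -, rfl⟩ := mem_linkPairs.1 he
    exact (hI F hF).2.2 (mem_sdiff.1 hze).1
  · split_ifs with hBJ
    swap
    · exact Or.inl rfl
    refine Or.inr ⟨rfl, ?_⟩
    obtain ⟨F, hF, rfl⟩ := mem_image.1 hBJ
    obtain ⟨hF𝓕, hFd, hzF⟩ := hJ F hF
    have hBF : (c F).erase z ⊆ F := (erase_subset _ _).trans (hc.subset hF𝓕)
    have hmem : F \ (c F).erase z ∈ linkPairs 𝓕 ((c F).erase z) :=
      mem_linkPairs.2 ⟨F, hF𝓕, hBF, rfl⟩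
    have hpair : ∀ w, {z, w} ∈ linkPairs 𝓕 ((c F).erase z) → {z, w} = F \ (c F).erase z := by
      intro w hw
      obtain ⟨G, hG, hBG, hw⟩ := mem_linkPairs.1 hw
      have hzG : z ∈ G \ (c F).erase z := hw ▸ mem_insert_self _ _
      rw [← hw, IsCert.eq_of_subset hu hF𝓕 (hc F hF𝓕).1 hFd hG]
      rw [← insert_erase hzF]
      exact insert_subset (mem_sdiff.1 hzG).1 hBG
    have hz : z ∈ F \ (c F).erase z :=
      mem_sdiff.2 ⟨hc.subset hF𝓕 hzF, notMem_erase _ _⟩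
    obtain ⟨v, hv, hins⟩ := exists_eq_insert_of_card (singleton_subset_iff.2 hz)
      (by rw [h2 _ hmem, card_singleton])
    have hins' : F \ (c F).erase z = {z, v} := hins.trans (pair_comm v z)
    refine ⟨v, hins' ▸ hmem, fun w hw => ?_⟩
    have hvw : v ∈ ({z, w} : Finset (Fin n)) := by rw [hpair w hw, hins']; simp
    rw [mem_insert, mem_singleton] at hvw
    exact (hvw.resolve_left (by simpa using hv)).symm

theorem two_mul_card_add_card_le (hu : ∀ F ∈ 𝓕, F.card = d + 1) (hc : IsMaxCertAssignment 𝓕 c)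
    {V : Finset (Fin n)} {z : Fin n} (hz : z ∉ V) {I J N : Finset (Finset (Fin n))}
    (hI : ∀ F ∈ I, F ∈ 𝓕 ∧ (c F).card + 1 = d ∧ F ⊆ V)
    (hIc : ∀ F ∈ I, ∀ F', ¬ CertConflict d 𝓕 c F F')
    (hJ : ∀ F ∈ J, F ∈ 𝓕 ∧ (c F).card = d ∧ z ∈ c F ∧ F.erase z ⊆ V ∧
      ¬ IsCert 𝓕 F (F.erase z))
    (hN : ∀ D ⊆ V, D.card = d → (∃ F ∈ I ∪ J, D ⊆ F) → (∀ F ∈ 𝓕, ¬ IsCert 𝓕 F D) → D ∈ N) :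
    2 * J.card + I.card ≤ N.card + (powersetCard (d - 1) V).card := by
  let U : Finset (Fin n) → Finset (Fin n) := fun B =>
    ((linkPairs (I.filter fun F => c F = B) B).biUnion id).filter
      fun v => {z, v} ∉ linkPairs 𝓕 B
  let h2 : Finset (Fin n) → Finset (Fin n) := fun F => (c F).erase z
  have hU : ∀ B, ∀ v ∈ U B, ∃ F ∈ I, c F = B ∧ v ∈ F ∧ v ∉ B ∧ {z, v} ∉ linkPairs 𝓕 B := by
    intro B v hv
    obtain ⟨hv, hzv⟩ := mem_filter.1 hv
    obtain ⟨e, he, hve⟩ := mem_biUnion.1 hv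
    obtain ⟨F, hF, -, rfl⟩ := mem_linkPairs.1 he
    obtain ⟨hvF, hvB⟩ := mem_sdiff.1 hve
    exact ⟨F, (mem_filter.1 hF).1, (mem_filter.1 hF).2, hvF, hvB, hzv⟩
  have hzJ : ∀ F ∈ J, z ∈ F := fun F hF => hc.subset (hJ F hF).1 (hJ F hF).2.2.1
  have hIcard : I.card ≤ ∑ B ∈ I.image c, (U B).card + (I.image c \ J.image h2).card := by
    rw [card_eq_sum_card_image c I, ← filter_notMem_eq_sdiff, card_filter, ← sum_add_distrib]
    refine sum_le_sum fun B hB => ?_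
    obtain ⟨F, hF, rfl⟩ := mem_image.1 hB
    refine (card_filter_cert_eq_le_card_sdiff_add (z := z) (J := J) hu hc (hI F hF).2.1 ?_
      fun G hG => ⟨(hJ G hG).1, (hJ G hG).2.1, (hJ G hG).2.2.1⟩).trans_eq ?_
    · intro G hG
      obtain ⟨hG, hGF⟩ := mem_filter.1 hG
      exact ⟨(hI G hG).1, hGF, fun h => hz ((hI G hG).2.2 h)⟩
    · simp only [ite_not]
      rfl
  have hP : J.card + (I.image c \ J.image h2).card ≤ (powersetCard (d - 1) V).card := by
    have hinj : (J.image h2).card = J.card := card_image_of_injOn fun F hF G hG h => by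
      obtain ⟨hF𝓕, hFd, hzF, -⟩ := hJ F hF
      obtain ⟨hG𝓕, hGd, hzG, -⟩ := hJ G hG
      have : c F = c G := by
        rw [← insert_erase hzF, ← insert_erase hzG]
        exact congrArg (insert z) h
      exact (IsCert.eq_of_subset hu hF𝓕 (hc F hF𝓕).1 hFd hG𝓕 (this ▸ hc.subset hG𝓕)).symm
    rw [← hinj, add_comm, card_sdiff_add_card]
    refine card_le_card (union_subset (fun B hB => ?_) fun B hB => ?_)
    · obtain ⟨F, hF, rfl⟩ := mem_image.1 hB
      obtain ⟨hF𝓕, hFd, hFV⟩ := hI F hF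
      exact mem_powersetCard.2 ⟨(hc.subset hF𝓕).trans hFV, by omega⟩
    · obtain ⟨F, hF, rfl⟩ := mem_image.1 hB
      obtain ⟨hF𝓕, hFd, hzF, hFV, -⟩ := hJ F hF
      exact mem_powersetCard.2 ⟨(erase_subset_erase z (hc.subset hF𝓕)).trans hFV,
        by rw [card_erase_of_mem hzF, hFd]⟩
  have hNle : J.card + ∑ B ∈ I.image c, (U B).card ≤ N.card := by
    let Ψ : Finset (Fin n) → Finset (Finset (Fin n)) := fun B => (U B).image fun v => insert v B
    have hΨ : ∀ B, ∀ D ∈ Ψ B, ∃ F ∈ I, c F = B ∧ B ⊆ D ∧ D ⊆ F ∧ D.card = d ∧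
        insert z D \ B ∉ linkPairs 𝓕 B := by
      intro B D hD
      obtain ⟨v, hv, rfl⟩ := mem_image.1 hD
      obtain ⟨F, hF, rfl, hvF, hvB, hzv⟩ := hU B v hv
      obtain ⟨hF𝓕, hFd, hFV⟩ := hI F hF
      have hzB : z ∉ c F := fun h => hz (hFV (hc.subset hF𝓕 h))
      refine ⟨F, hF, rfl, subset_insert _ _, insert_subset hvF (hc.subset hF𝓕),
        by rw [card_insert_of_notMem hvB, hFd], ?_⟩
      rwa [insert_sdiff_of_notMem _ hzB, insert_sdiff_of_notMem _ hvB, sdiff_self]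
    have hΨcard : ∀ B, (Ψ B).card = (U B).card := fun B =>
      card_image_of_injOn fun v hv w hw h => by
        obtain ⟨-, -, -, -, hvB, -⟩ := hU B v hv
        exact (insert_inj hvB).1 h
    have hdisj : ((I.image c : Finset (Finset (Fin n))) : Set (Finset (Fin n))).PairwiseDisjoint
        Ψ := by
      intro B _ B' _ hne
      refine disjoint_left.2 fun D hD hD' => ?_
      obtain ⟨F, hF, rfl, hBD, hDF, -⟩ := hΨ B D hD
      obtain ⟨F', hF', rfl, hBD', hDF', -⟩ := hΨ B' D hD'
      exact hIc F hF F' ⟨(hI F' hF').1, (hI F hF).2.1, (hI F' hF').2.1, hne,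
        hBD.trans hDF', hBD'.trans hDF⟩
    have hinj : (J.image fun F => F.erase z).card = J.card :=
      card_image_of_injOn fun F hF G hG h => by
        rw [← insert_erase (hzJ F hF), ← insert_erase (hzJ G hG)]
        exact congrArg (insert z) h
    have hdisj' : Disjoint (J.image fun F => F.erase z) ((I.image c).biUnion Ψ) := by
      refine disjoint_left.2 fun D hD hD' => ?_
      obtain ⟨F, hF, rfl⟩ := mem_image.1 hD
      obtain ⟨B, -, hD'⟩ := mem_biUnion.1 hD'
      obtain ⟨G, hG, rfl, hBD, -, -, hlink⟩ := hΨ B _ hD'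
      rw [insert_erase (hzJ F hF)] at hlink
      exact hlink (mem_linkPairs.2 ⟨F, (hJ F hF).1, hBD.trans (erase_subset _ _), rfl⟩)
    rw [← hinj, ← sum_congr rfl fun B _ => hΨcard B, ← card_biUnion hdisj,
      ← card_union_of_disjoint hdisj']
    refine card_le_card (union_subset (fun D hD => ?_) fun D hD => ?_)
    · obtain ⟨F, hF, rfl⟩ := mem_image.1 hD
      obtain ⟨hF𝓕, -, -, hFV, hown⟩ := hJ F hF
      have hcard : (F.erase z).card = d := by rw [card_erase_of_mem (hzJ F hF), hu F hF𝓕]; rfl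
      refine hN _ hFV hcard ⟨F, mem_union_right _ hF, erase_subset _ _⟩ fun G hG hcert => hown ?_
      obtain rfl := IsCert.eq_of_subset hu hG hcert hcard hF𝓕 (erase_subset _ _)
      exact hcert
    · obtain ⟨B, -, hD⟩ := mem_biUnion.1 hD
      obtain ⟨F, hF, rfl, -, hDF, hDd, -⟩ := hΨ B D hD
      obtain ⟨hF𝓕, hFd, hFV⟩ := hI F hF
      refine hN D (hDF.trans hFV) hDd ⟨F, mem_union_left _ hF, hDF⟩ fun G hG hcert => ?_
      rw [← IsCert.eq_of_subset hu hG hcert hDd hF𝓕 hDF] at hcert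
      have := (hc F hF𝓕).2 D hcert
      omega
  omega

theorem card_famS (hd : 1 ≤ d) (V : Finset (Fin n)) (ℋ : Finset (Finset (Fin n))) :
    (famS d V ℋ).card = (powersetCard (d - 1) V).card +
      (powersetCard d V \ compShadow d ℋ).card := by
  refine card_union_of_disjoint (disjoint_left.2 fun D hD hD' => ?_)
  have h1 := (mem_powersetCard.1 hD).2
  have h2 := (mem_powersetCard.1 (mem_sdiff.1 hD').1).2
  omega

theorem notMem_compShadow_of_subset {ℋ : Finset (Finset (Fin n))} {D F : Finset (Fin n)}
    (hF : F ∈ ℋ) (hFd : F.card = d + 1) (hDF : D ⊆ F) (hD : D.card = d) :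
    D ∉ compShadow d ℋ := fun h =>
  (mem_sdiff.1 h).2 (mem_filter.2 ⟨mem_univ _, F, hF, hDF, by omega⟩)

theorem card_le_card_famS (hd : 1 ≤ d) (hu : ∀ F ∈ 𝓕, F.card = d + 1)
    (hc : IsMaxCertAssignment 𝓕 c) {V : Finset (Fin n)} {x y : Fin n}
    (hV : ∀ v, v ∈ V ↔ v ≠ x ∧ v ≠ y) {ℋ : Finset (Finset (Fin n))} (hℋ : ℋ ⊆ 𝓕)
    (hconf : ∀ F ∈ ℋ, ∀ F', ¬ CertConflict d 𝓕 c F F')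
    (hcard : ∀ F ∈ ℋ, (c F).card = d ∨ (c F).card + 1 = d ∧ F ⊆ V)
    (hxy : ∀ F ∈ ℋ, ¬ (x ∈ F ∧ y ∈ F)) : ℋ.card ≤ (famS d V ℋ).card := by
  classical
  let own : Finset (Fin n) → Prop := fun F => ∃ D ⊆ V, D.card = d ∧ IsCert 𝓕 F D
  let S := powersetCard d V \ compShadow d ℋ
  let isOwned : Finset (Fin n) → Prop := fun D => ∃ F ∈ 𝓕, IsCert 𝓕 F D
  let I := ℋ.filter fun F => (c F).card + 1 = d ∧ F ⊆ V
  let J : Fin n → Finset (Finset (Fin n)) := fun z =>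
    ℋ.filter fun F => ¬ own F ∧ (c F).card = d ∧ z ∈ c F
  have hmemS : ∀ F ∈ ℋ, ∀ D ⊆ F, D ⊆ V → D.card = d → D ∈ S := fun F hF D hDF hDV hD =>
    mem_sdiff.2 ⟨mem_powersetCard.2 ⟨hDV, hD⟩,
      notMem_compShadow_of_subset hF (hu F (hℋ hF)) hDF hD⟩
  have hown : (ℋ.filter own).card ≤ (S.filter isOwned).card := by
    have hex : ∀ F, ∃ D, own F → D ⊆ V ∧ D.card = d ∧ IsCert 𝓕 F D := fun F => by
      by_cases h : own F
      · exact h.imp fun D hD _ => hD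
      · exact ⟨∅, fun h' => absurd h' h⟩
    choose g hg using hex
    refine card_le_card_of_injOn g (fun F hF => ?_) fun F hF G hG h => ?_
    · obtain ⟨hF, hoF⟩ := mem_filter.1 hF
      obtain ⟨h1, h2, h3⟩ := hg F hoF
      exact mem_filter.2 ⟨hmemS F hF _ h3.1.1 h1 h2, F, hℋ hF, h3⟩
    · obtain ⟨hF, hoF⟩ := mem_filter.1 hF
      obtain ⟨hG, hoG⟩ := mem_filter.1 hG
      obtain ⟨-, h2, h3⟩ := hg F hoF
      obtain ⟨-, -, k3⟩ := hg G hoG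
      exact (IsCert.eq_of_subset hu (hℋ hF) h3 h2 (hℋ hG) (h ▸ k3.1.1)).symm
  have hz : ∀ z w, z ∉ V → (∀ v, v ≠ z → v ≠ w → v ∈ V) →
      (∀ F ∈ ℋ, ¬ (z ∈ F ∧ w ∈ F)) →
      2 * (J z).card + I.card ≤
        (S.filter fun D => ¬ isOwned D).card + (powersetCard (d - 1) V).card := by
    intro z w hzV hzw hnot
    refine two_mul_card_add_card_le hu hc hzV (fun F hF => ?_) (fun F hF => ?_)
      (fun F hF => ?_) fun D hDV hD hDF hcert => ?_
    · exact ⟨hℋ (mem_filter.1 hF).1, (mem_filter.1 hF).2⟩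
    · exact hconf F (mem_filter.1 hF).1
    · obtain ⟨hF, hoF, hFd, hzF⟩ := mem_filter.1 hF
      have hFV : F.erase z ⊆ V := fun v hv => by
        obtain ⟨hvz, hvF⟩ := mem_erase.1 hv
        refine hzw v hvz ?_
        rintro rfl
        exact hnot F hF ⟨hc.subset (hℋ hF) hzF, hvF⟩
      refine ⟨hℋ hF, hFd, hzF, hFV, fun h => hoF ⟨_, hFV, ?_, h⟩⟩
      rw [card_erase_of_mem (hc.subset (hℋ hF) hzF), hu F (hℋ hF)]
      rfl
    · obtain ⟨F, hF, hDF⟩ := hDF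
      have hF' : F ∈ ℋ := (mem_union.1 hF).elim (fun h => (mem_filter.1 h).1)
        fun h => (mem_filter.1 h).1
      exact mem_filter.2 ⟨hmemS F hF' D hDF hDV hD, fun ⟨G, hG, h⟩ => hcert G hG h⟩
  have hx := hz x y (fun h => ((hV x).1 h).1 rfl) (fun v h1 h2 => (hV v).2 ⟨h1, h2⟩) hxy
  have hy := hz y x (fun h => ((hV y).1 h).2 rfl) (fun v h1 h2 => (hV v).2 ⟨h2, h1⟩)
    fun F hF h => hxy F hF h.symm
  have hcover : ℋ ⊆ ℋ.filter own ∪ (J x ∪ J y ∪ I) := by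
    intro F hF
    by_cases hoF : own F
    · exact mem_union_left _ (mem_filter.2 ⟨hF, hoF⟩)
    refine mem_union_right _ ?_
    rcases hcard F hF with hFd | h
    · refine mem_union_left _ ?_
      by_contra hnot
      refine hoF ⟨c F, fun v hv => (hV v).2 ⟨?_, ?_⟩, hFd, (hc F (hℋ hF)).1⟩
      · rintro rfl
        exact hnot (mem_union_left _ (mem_filter.2 ⟨hF, hoF, hFd, hv⟩))
      · rintro rfl
        exact hnot (mem_union_right _ (mem_filter.2 ⟨hF, hoF, hFd, hv⟩))
    · exact mem_union_right _ (mem_filter.2 ⟨hF, h⟩)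
  have h1 := (card_le_card hcover).trans (card_union_le _ _)
  have h2 := card_union_le (J x ∪ J y) I
  have h3 := card_union_le (J x) (J y)
  have h4 := card_filter_add_card_filter_not (s := S) isOwned
  rw [card_famS hd]
  change _ ≤ _ + S.card
  omega

theorem card_filter_lt_mul_le (f : Fin n → ℕ) (K : ℕ) :
    (univ.filter fun v => K * ∑ w, f w < n * f v).card * K ≤ n := by
  set B := univ.filter fun v => K * ∑ w, f w < n * f v
  rcases Nat.eq_zero_or_pos (∑ w, f w) with h | h
  · have : B = ∅ := filter_eq_empty_iff.2 fun v hv => by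
      simp [sum_eq_zero_iff.1 h v hv]
    simp [this]
  · refine Nat.le_of_mul_le_mul_right ?_ h
    rw [mul_assoc, ← smul_eq_mul]
    refine (card_nsmul_le_sum B (fun v => n * f v) _ fun v hv => (mem_filter.1 hv).2.le).trans ?_
    rw [← mul_sum]
    exact Nat.mul_le_mul_left _ (sum_le_sum_of_subset (subset_univ _))

theorem exists_ne_mul_le (hn : 3 ≤ n) (f g h : Fin n → ℕ) (w : Fin n) :
    ∃ v ≠ w, n * f v ≤ 4 * ∑ u, f u ∧ n * g v ≤ 8 * ∑ u, g u ∧ n * h v ≤ 8 * ∑ u, h u := by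
  by_contra! hcon
  have hcover : (univ : Finset (Fin n)) ⊆ {w} ∪ ((univ.filter fun v => 4 * ∑ u, f u < n * f v) ∪
      ((univ.filter fun v => 8 * ∑ u, g u < n * g v) ∪
        univ.filter fun v => 8 * ∑ u, h u < n * h v)) := by
    intro v _
    simp only [mem_union, mem_singleton, mem_filter, mem_univ, true_and]
    by_cases hvw : v = w
    · exact Or.inl hvw
    · have := hcon v hvw
      by_contra! hnot
      exact absurd (this hnot.2.1 hnot.2.2.1) hnot.2.2.2.not_gt
  have h0 := card_le_card hcover
  rw [card_univ, Fintype.card_fin] at h0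
  have h1 := h0.trans ((card_union_le _ _).trans (Nat.add_le_add_left ((card_union_le _ _).trans
    (Nat.add_le_add_left (card_union_le _ _) _)) _))
  have h2 := card_filter_lt_mul_le f 4
  have h3 := card_filter_lt_mul_le g 8
  have h4 := card_filter_lt_mul_le h 8
  rw [card_singleton] at h1
  omega

theorem sum_card_filter_mem {𝒟 : Finset (Finset (Fin n))} {k : ℕ} (h : ∀ D ∈ 𝒟, D.card = k) :
    ∑ v, (𝒟.filter fun D => v ∈ D).card = 𝒟.card * k := by
  refine (sum_card_bipartiteAbove_eq_sum_card_bipartiteBelow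
    (fun (v : Fin n) (D : Finset (Fin n)) => v ∈ D)).trans ?_
  rw [← smul_eq_mul, ← sum_const]
  refine sum_congr rfl fun D hD => ?_
  simp [bipartiteBelow, h D hD]

theorem exists_pair_card_filter_le (hn : 3 ≤ n) {m a b : ℕ} {𝒟 𝒮 : Finset (Finset (Fin n))}
    (h𝓕 : ∀ F ∈ 𝓕, F.card = m + 3) (h𝒮 : ∀ F ∈ 𝒮, F.card = m + 3)
    (h𝒟 : ∀ D ∈ 𝒟, D.card = m + 2) (h𝒮' : 𝒮.card ≤ a * n ^ (m + 1))
    (h𝓕' : 𝓕.card ≤ b * n ^ (m + 2)) :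
    ∃ x y, x ≠ y ∧
      n * ((𝒟.filter fun D => x ∈ D).card + (𝒟.filter fun D => y ∈ D).card) ≤
        8 * (m + 2) * 𝒟.card ∧
      (𝒮.filter fun F => x ∈ F).card ≤ 8 * (m + 3) * a * n ^ m ∧
      (𝒮.filter fun F => y ∈ F).card ≤ 8 * (m + 3) * a * n ^ m ∧
      (𝓕.filter fun F => x ∈ F ∧ y ∈ F).card ≤ 64 * (m + 3) ^ 2 * b * n ^ m := by
  have hn0 : 0 < n := by omega
  obtain ⟨x, -, hx1, hx2, hx3⟩ := exists_ne_mul_le hn (fun v => (𝒟.filter fun D => v ∈ D).card)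
    (fun v => (𝒮.filter fun F => v ∈ F).card) (fun v => (𝓕.filter fun F => v ∈ F).card) ⟨0, hn0⟩
  obtain ⟨y, hyx, hy1, hy2, hy3⟩ := exists_ne_mul_le hn
    (fun v => (𝒟.filter fun D => v ∈ D).card) (fun v => (𝒮.filter fun F => v ∈ F).card)
    (fun v => ((𝓕.filter fun F => x ∈ F).filter fun F => v ∈ F).card) x
  rw [sum_card_filter_mem fun F hF => h𝓕 F (mem_filter.1 hF).1, filter_filter] at hy3
  simp only [sum_card_filter_mem h𝒟, sum_card_filter_mem h𝒮, sum_card_filter_mem h𝓕]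
    at hx1 hx2 hx3 hy1 hy2
  have hS : 8 * (𝒮.card * (m + 3)) ≤ n * (8 * (m + 3) * a * n ^ m) :=
    calc 8 * (𝒮.card * (m + 3)) ≤ 8 * (a * n ^ (m + 1) * (m + 3)) := by gcongr
      _ = n * (8 * (m + 3) * a * n ^ m) := by ring
  have hdeg : (𝓕.filter fun F => x ∈ F).card ≤ 8 * (m + 3) * b * n ^ (m + 1) := by
    refine Nat.le_of_mul_le_mul_left (hx3.trans ?_) hn0
    calc 8 * (𝓕.card * (m + 3)) ≤ 8 * (b * n ^ (m + 2) * (m + 3)) := by gcongr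
      _ = n * (8 * (m + 3) * b * n ^ (m + 1)) := by ring
  refine ⟨x, y, hyx.symm, by linarith, Nat.le_of_mul_le_mul_left (hx2.trans hS) hn0,
    Nat.le_of_mul_le_mul_left (hy2.trans hS) hn0, Nat.le_of_mul_le_mul_left (hy3.trans ?_) hn0⟩
  calc 8 * ((𝓕.filter fun F => x ∈ F).card * (m + 3))
      ≤ 8 * (8 * (m + 3) * b * n ^ (m + 1) * (m + 3)) := by gcongr
    _ = n * (64 * (m + 3) ^ 2 * b * n ^ m) := by ring

theorem exists_injOn_of_card_le {α β : Type*} [Inhabited β] {s : Finset α} {t : Finset β}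
    (h : s.card ≤ t.card) :
    ∃ g : α → β, (∀ a ∈ s, g a ∈ t) ∧ ∀ a ∈ s, ∀ b ∈ s, g a = g b → a = b := by
  classical
  obtain ⟨e⟩ : Nonempty (s ↪ t) := Function.Embedding.nonempty_of_card_le (by simpa using h)
  refine ⟨fun a => if h : a ∈ s then e ⟨a, h⟩ else default, fun a ha => ?_, fun a ha b hb hab => ?_⟩
  · simp [ha]
  · simpa [ha, hb] using hab

theorem stmt12 (d : ℕ) (hd : 2 ≤ d) :
    ∃ C : ℝ, ∃ n₀ : ℕ, ∀ n : ℕ, n₀ ≤ n → ∀ 𝓕 : Finset (Finset (Fin n)),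
      (∀ F ∈ 𝓕, F.card = d + 1) → VCDimLE 𝓕 d →
      ∃ V : Finset (Fin n), V.card = n - 2 ∧
      ∃ 𝓕₁ 𝓕₂ 𝓕₃ : Finset (Finset (Fin n)),
        𝓕 = 𝓕₁ ∪ 𝓕₂ ∪ 𝓕₃ ∧ Disjoint 𝓕₁ 𝓕₂ ∧ Disjoint 𝓕₁ 𝓕₃ ∧ Disjoint 𝓕₂ 𝓕₃ ∧
        (((𝓕₁ ∪ 𝓕₂).card : ℝ) ≤ 0.1 * ((compShadow d 𝓕).card : ℝ) + C * n ^ (d - 2)) ∧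
        ((((compShadow d (𝓕₂ ∪ 𝓕₃)).filter (fun D => D ⊆ V)).card : ℝ) ≥
          (1 - 8 * d / n) * ((compShadow d (𝓕₂ ∪ 𝓕₃)).card : ℝ)) ∧
        (∃ g : Finset (Fin n) → Finset (Fin n),
          (∀ F ∈ 𝓕₃, g F ∈ famS d V 𝓕₃) ∧
          (∀ F ∈ 𝓕₃, ∀ F' ∈ 𝓕₃, g F = g F' → F = F')) ∧
        ((𝓕₃.card : ℤ) ≤ ((n - 2).choose (d - 1) : ℤ) + ((n - 2).choose d : ℤ) -
          ((compShadow d 𝓕₃ ∩ Finset.powersetCard d V).card : ℤ)) := by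
  classical
  obtain ⟨m, rfl⟩ : ∃ m, d = m + 2 := ⟨d - 2, by omega⟩
  set A : ℕ := (m + 2 + 1) ^ (m + 2 + 1)
  set K : ℝ := 2 * ((m + 2 : ℕ) + 1) * certNearBound (m + 2) +
    certNearBound (m + 2) ^ 2 * (10 * 2 ^ (m + 2))
  refine ⟨K + ((m + 1) * A + 2 * (8 * (m + 3) * ((m + 2) * A)) +
    64 * (m + 3) ^ 2 * ((m + 3) * A)), 3, fun n hn 𝓕 hu hvc => ?_⟩
  obtain ⟨c, hc⟩ := exists_isMaxCertAssignment hu hvc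
  have hlow := fun j => card_filter_cert_card_le (by omega : 1 ≤ n) hu hc j
  have hconf := card_certConflict_le hd hu hc
  set 𝓒 := 𝓕.filter fun F => ∃ F', CertConflict (m + 2) 𝓕 c F F'
  set 𝓕₁ := 𝓕.filter (fun F => (c F).card ≤ m) ∪ 𝓒 with h𝓕₁
  set 𝓖 := 𝓕 \ 𝓕₁ with h𝓖
  obtain ⟨x, y, hxy, hD, hx, hy, hcodeg⟩ := exists_pair_card_filter_le (𝓕 := 𝓕) (m := m)
    (a := (m + 2) * A) (b := (m + 3) * A) (𝒟 := compShadow (m + 2) 𝓖)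
    (𝒮 := 𝓕.filter fun F => (c F).card ≤ m + 1) hn hu (fun F hF => hu F (mem_filter.1 hF).1)
    (fun D hD => (mem_powersetCard.1 (mem_sdiff.1 hD).1).2)
    ((hlow (m + 1)).trans_eq (by ring)) (by
      have := hlow (m + 2)
      rw [filter_true_of_mem fun F hF => IsMaxCertAssignment.card_le hu hc hF] at this
      exact this.trans_eq (by ring))
  set p : Finset (Fin n) → Prop := fun F =>
    (x ∈ F ∧ y ∈ F) ∨ ((c F).card ≤ m + 1 ∧ (x ∈ F ∨ y ∈ F)) with hp
  have hVcard : ((univ : Finset (Fin n)) \ {x, y}).card = n - 2 := by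
    rw [card_sdiff_of_subset (subset_univ _), card_pair hxy, card_univ, Fintype.card_fin]
  set V : Finset (Fin n) := univ \ {x, y} with hVdef
  have hV : ∀ v, v ∈ V ↔ v ≠ x ∧ v ≠ y := fun v => by simp [hVdef]
  have hun : 𝓖.filter p ∪ 𝓖.filter (fun F => ¬ p F) = 𝓖 := filter_union_filter_not_eq _ _
  have h₃ : (𝓖.filter fun F => ¬ p F).card ≤
      (famS (m + 2) V (𝓖.filter fun F => ¬ p F)).card := by
    have hnot : ∀ F ∈ 𝓖.filter (fun F => ¬ p F), F ∈ 𝓕 ∧ m < (c F).card ∧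
        (∀ F', ¬ CertConflict (m + 2) 𝓕 c F F') ∧ ¬ p F := by
      intro F hF
      obtain ⟨hF, hpF⟩ := mem_filter.1 hF
      obtain ⟨hF, hF₁⟩ := mem_sdiff.1 hF
      rw [h𝓕₁, mem_union, not_or] at hF₁
      exact ⟨hF, not_le.1 fun h => hF₁.1 (mem_filter.2 ⟨hF, h⟩),
        fun F' h => hF₁.2 (mem_filter.2 ⟨hF, F', h⟩), hpF⟩
    refine card_le_card_famS (by omega) hu hc hV (fun F hF => (hnot F hF).1)
      (fun F hF => (hnot F hF).2.2.1) (fun F hF => ?_)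
      fun F hF h => (hnot F hF).2.2.2 (Or.inl h)
    obtain ⟨hF𝓕, hm, -, hpF⟩ := hnot F hF
    have hle := IsMaxCertAssignment.card_le hu hc hF𝓕
    rcases Nat.lt_or_ge (m + 1) (c F).card with h | h
    · exact Or.inl (by omega)
    · refine Or.inr ⟨by omega, fun v hv => (hV v).2 ⟨?_, ?_⟩⟩
      · rintro rfl
        exact hpF (Or.inr ⟨h, Or.inl hv⟩)
      · rintro rfl
        exact hpF (Or.inr ⟨h, Or.inr hv⟩)
  refine ⟨V, hVcard, 𝓕₁, 𝓖.filter p, 𝓖.filter fun F => ¬ p F, ?_, ?_, ?_, ?_, ?_, ?_,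
    exists_injOn_of_card_le h₃, ?_⟩
  · rw [union_assoc, hun, h𝓖, union_sdiff_of_subset]
    exact union_subset (filter_subset _ _) (filter_subset _ _)
  · exact disjoint_of_subset_right (filter_subset _ _) disjoint_sdiff
  · exact disjoint_of_subset_right (filter_subset _ _) disjoint_sdiff
  · exact disjoint_filter_filter_not _ _ _
  · have hsub : 𝓖.filter p ⊆ (𝓕.filter fun F => x ∈ F ∧ y ∈ F) ∪
        (((𝓕.filter fun F => (c F).card ≤ m + 1).filter fun F => x ∈ F) ∪
          (𝓕.filter fun F => (c F).card ≤ m + 1).filter fun F => y ∈ F) := by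
      intro F hF
      obtain ⟨hF, hpF⟩ := mem_filter.1 hF
      have hF := (mem_sdiff.1 hF).1
      simp only [mem_union, mem_filter]
      tauto
    have h1 : (𝓕₁ ∪ 𝓖.filter p).card ≤ (m + 1) * n ^ m * A + 𝓒.card +
        (64 * (m + 3) ^ 2 * ((m + 3) * A) * n ^ m + (8 * (m + 3) * ((m + 2) * A) * n ^ m +
          8 * (m + 3) * ((m + 2) * A) * n ^ m)) := by
      refine (card_union_le _ _).trans (add_le_add ((card_union_le _ _).trans
        (Nat.add_le_add_right (hlow m) _)) ((card_le_card hsub).trans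
        ((card_union_le _ _).trans (add_le_add hcodeg ?_))))
      exact (card_union_le _ _).trans (add_le_add hx hy)
    have h2 : ((𝓕₁ ∪ 𝓖.filter p).card : ℝ) ≤ (m + 1) * n ^ m * A + 𝓒.card +
        (64 * (m + 3) ^ 2 * ((m + 3) * A) * n ^ m + (8 * (m + 3) * ((m + 2) * A) * n ^ m +
          8 * (m + 3) * ((m + 2) * A) * n ^ m)) := by exact_mod_cast h1
    rw [show m + 2 - 2 = m from rfl] at hconf ⊢
    linarith
  · rw [hun]
    set 𝒟 := compShadow (m + 2) 𝓖
    have hsub : 𝒟 ⊆ 𝒟.filter (fun D => D ⊆ V) ∪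
        ((𝒟.filter fun D => x ∈ D) ∪ 𝒟.filter fun D => y ∈ D) := by
      intro D hD
      simp only [mem_union, mem_filter, hD, true_and]
      by_contra! h
      refine h.1 fun v hv => (hV v).2 ⟨?_, ?_⟩
      · rintro rfl
        exact h.2.1 hv
      · rintro rfl
        exact h.2.2 hv
    have h1 := (card_le_card hsub).trans ((card_union_le _ _).trans
      (Nat.add_le_add_left (card_union_le _ _) _))
    have h1' : (𝒟.card : ℝ) ≤ (𝒟.filter fun D => D ⊆ V).card +
      (((𝒟.filter fun D => x ∈ D).card : ℝ) + (𝒟.filter fun D => y ∈ D).card) := by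
        exact_mod_cast h1
    have h2 : (n : ℝ) * (((𝒟.filter fun D => x ∈ D).card : ℝ) + (𝒟.filter fun D => y ∈ D).card) ≤
        8 * (m + 2) * 𝒟.card := by exact_mod_cast hD
    have hn0 : (0 : ℝ) < n := by exact_mod_cast (by omega : 0 < n)
    rw [mul_comm (n : ℝ), ← le_div_iff₀ hn0] at h2
    have h3 : (1 - 8 * ((m + 2 : ℕ) : ℝ) / n) * 𝒟.card = 𝒟.card - 8 * (m + 2) * 𝒟.card / n := by
      push_cast
      ring
    rw [ge_iff_le, h3]
    linarith
  · rw [card_famS (by omega)] at h₃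
    have h1 := card_sdiff_add_card_inter (powersetCard (m + 2) V)
      (compShadow (m + 2) (𝓖.filter fun F => ¬ p F))
    rw [card_powersetCard, hVcard, inter_comm] at h1
    rw [card_powersetCard, hVcard] at h₃
    omega
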